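/- For any Banach space X, λ⁺_X(r) > 0 for all r ∈ (0,1], and consequently λ⁺_X is strictly increasing on [0,1] with λ⁺_X(1) = 1. -/

import Mathlib

noncomputable def suppLam {X : Type*} [NormedAddCommGroup X] [NormedSpace ℝ X]
    (x y : X) (r : ℝ) : ℝ := sInf {l : ℝ | ‖x + r • y - l • x‖ = 1}

/-- `y` is quasiorthogonal to `x`: some norming functional of `x` vanishes at `y`. -/
def Quasiorth {X : Type*} [NormedAddCommGroup X] [NormedSpace ℝ X] (x y : X) : Prop :=
  ∃ p : X →L[ℝ] ℝ, ‖p‖ = 1 ∧ p x = ‖x‖ ∧ p y = 0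

/-- Modulus of supporting convexity `λ⁻_X`. -/
noncomputable def suppConvexity (X : Type*) [NormedAddCommGroup X] [NormedSpace ℝ X]
    (r : ℝ) : ℝ :=
  sInf {v : ℝ | ∃ (x y : X) (t : ℝ), ‖x‖ = 1 ∧ ‖y‖ = 1 ∧ Quasiorth x y ∧
    0 ≤ t ∧ t ≤ r ∧ v = min (suppLam x y t) (suppLam x (-y) t)}

/-- Modulus of supporting smoothness `λ⁺_X`. -/
noncomputable def suppSmoothness (X : Type*) [NormedAddCommGroup X] [NormedSpace ℝ X]
    (r : ℝ) : ℝ :=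
  sSup {v : ℝ | ∃ (x y : X) (t : ℝ), ‖x‖ = 1 ∧ ‖y‖ = 1 ∧ Quasiorth x y ∧
    0 ≤ t ∧ t ≤ r ∧ v = max (suppLam x y t) (suppLam x (-y) t)}

/-- Modulus of convexity `δ_X`. -/
noncomputable def modConvexity (X : Type*) [NormedAddCommGroup X] [NormedSpace ℝ X]
    (ε : ℝ) : ℝ :=
  sInf {v : ℝ | ∃ x y : X, ‖x‖ ≤ 1 ∧ ‖y‖ ≤ 1 ∧ ε ≤ ‖x - y‖ ∧ v = 1 - ‖x + y‖ / 2}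

/-- Modulus of smoothness `ρ_X`. -/
noncomputable def modSmoothness (X : Type*) [NormedAddCommGroup X] [NormedSpace ℝ X]
    (τ : ℝ) : ℝ :=
  sSup {v : ℝ | ∃ x y : X, ‖x‖ = 1 ∧ ‖y‖ = τ ∧ v = ‖x + y‖ / 2 + ‖x - y‖ / 2 - 1}

/-- Banaś modulus `b_X`. -/
noncomputable def banasMod (X : Type*) [NormedAddCommGroup X] [NormedSpace ℝ X]
    (ε : ℝ) : ℝ :=
  sSup {v : ℝ | ∃ x y : X, ‖x‖ ≤ 1 ∧ ‖y‖ ≤ 1 ∧ ‖x - y‖ ≤ ε ∧ v = 1 - ‖x + y‖ / 2}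

section Helpers

variable {X : Type*} [NormedAddCommGroup X] [NormedSpace ℝ X]

lemma Quasiorth.neg' {x y : X} (h : Quasiorth x y) : Quasiorth x (-y) := by
  obtain ⟨p, h1, h2, h3⟩ := h
  exact ⟨p, h1, h2, by simp [h3]⟩

lemma Quasiorth.le_norm {x y : X} (h : Quasiorth x y) (hx : ‖x‖ = 1) (t l : ℝ) :
    1 - l ≤ ‖x + t • y - l • x‖ := by
  obtain ⟨p, h1, h2, h3⟩ := h
  have h4 := p.le_opNorm (x + t • y - l • x)
  have h5 : p (x + t • y - l • x) = 1 - l := by simp [h2, h3, hx]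
  rw [h5, h1, one_mul, Real.norm_eq_abs] at h4
  exact (le_abs_self _).trans h4

lemma suppLam_le {x y : X} (h : Quasiorth x y) (hx : ‖x‖ = 1) {t l : ℝ}
    (hl : ‖x + t • y - l • x‖ ≤ 1) : suppLam x y t ≤ l := by
  have hl0 : 0 ≤ l := by linarith [h.le_norm hx t l]
  have hc : ContinuousOn (fun l : ℝ => ‖x + t • y - l • x‖) (Set.Icc 0 l) := by fun_prop
  have h0 : 1 ≤ ‖x + t • y - (0 : ℝ) • x‖ := by linarith [h.le_norm hx t 0]
  obtain ⟨m, hm, hm1⟩ := intermediate_value_Icc' hl0 hc ⟨hl, h0⟩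
  refine le_trans (csInf_le ⟨0, ?_⟩ hm1) hm.2
  intro k hk
  have := h.le_norm hx t k
  rw [Set.mem_ofPred_eq] at hk
  linarith

lemma suppLam_mem {x y : X} (h : Quasiorth x y) (hx : ‖x‖ = 1) (hy : ‖y‖ = 1) {t : ℝ}
    (ht : 0 ≤ t) (ht1 : t ≤ 1) : ‖x + t • y - suppLam x y t • x‖ = 1 := by
  have hc : Continuous (fun l : ℝ => ‖x + t • y - l • x‖) := by fun_prop
  have h0 : 1 ≤ ‖x + t • y - (0 : ℝ) • x‖ := by linarith [h.le_norm hx t 0]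
  have h1 : ‖x + t • y - (1 : ℝ) • x‖ ≤ 1 := by
    simp [norm_smul, hy, abs_of_nonneg ht, ht1]
  obtain ⟨m, hm, hm1⟩ := intermediate_value_Icc' zero_le_one hc.continuousOn ⟨h1, h0⟩
  have hcl : IsClosed {l : ℝ | ‖x + t • y - l • x‖ = 1} := isClosed_eq hc continuous_const
  refine hcl.csInf_mem ⟨m, hm1⟩ ⟨0, ?_⟩
  intro k hk
  have := h.le_norm hx t k
  rw [Set.mem_ofPred_eq] at hk
  linarith

lemma suppLam_nonneg {x y : X} (h : Quasiorth x y) (hx : ‖x‖ = 1) (hy : ‖y‖ = 1) {t : ℝ}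
    (ht : 0 ≤ t) (ht1 : t ≤ 1) : 0 ≤ suppLam x y t := by
  linarith [h.le_norm hx t (suppLam x y t), suppLam_mem h hx hy ht ht1]

lemma suppLam_le_one {x y : X} (h : Quasiorth x y) (hx : ‖x‖ = 1) (hy : ‖y‖ = 1) {t : ℝ}
    (ht : 0 ≤ t) (ht1 : t ≤ 1) : suppLam x y t ≤ 1 := by
  refine suppLam_le h hx ?_
  simp [norm_smul, hy, abs_of_nonneg ht, ht1]

lemma suppLam_scale {x y : X} (h : Quasiorth x y) (hx : ‖x‖ = 1) (hy : ‖y‖ = 1) {t b : ℝ}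
    (ht : 0 ≤ t) (htb : t ≤ b) (hb : 0 < b) (hb1 : b ≤ 1) :
    suppLam x y t ≤ t / b * suppLam x y b := by
  refine suppLam_le h hx ?_
  have h1 := suppLam_mem h hx hy hb.le hb1
  set L := suppLam x y b
  have hc0 : 0 ≤ t / b := by positivity
  have hc1 : t / b ≤ 1 := (div_le_one hb).2 htb
  have hcb : t = t / b * b := by field_simp
  set c := t / b
  have : x + t • y - (c * L) • x = (1 - c) • x + c • (x + b • y - L • x) := by
    rw [hcb]; module
  rw [this]
  refine (norm_add_le _ _).trans ?_
  rw [norm_smul, norm_smul, h1, hx, Real.norm_of_nonneg hc0, Real.norm_of_nonneg (by linarith)]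
  linarith

lemma exists_ext_pt (V : Type*) [NormedAddCommGroup V] [NormedSpace ℝ V] [FiniteDimensional ℝ V]
    [Nontrivial V] : ∃ e : V, ‖e‖ = 1 ∧ ∀ v : V, v ≠ 0 → 1 < ‖e + v‖ ∨ 1 < ‖e - v‖ := by
  have : ProperSpace V := FiniteDimensional.proper ℝ V
  obtain ⟨e, he⟩ := (isCompact_closedBall (0 : V) 1).extremePoints_nonempty ⟨0, by simp⟩
  rw [mem_extremePoints_iff_left] at he
  obtain ⟨he1, he2⟩ := he
  have key : ∀ v : V, v ≠ 0 → 1 < ‖e + v‖ ∨ 1 < ‖e - v‖ := by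
    intro v hv
    by_contra! hcon
    have := he2 (e + v) (by simpa using hcon.1) (e - v) (by simpa using hcon.2)
      ⟨1 / 2, 1 / 2, by norm_num, by norm_num, by norm_num, by module⟩
    exact hv (by simpa using this)
  refine ⟨e, ?_, key⟩
  have he1' : ‖e‖ ≤ 1 := by simpa using he1
  refine le_antisymm he1' ?_
  by_contra! hlt
  obtain ⟨v, hv⟩ := exists_norm_eq V (c := 1 - ‖e‖) (by linarith)
  have hv0 : v ≠ 0 := by
    rintro rfl
    simp at hv; linarith
  rcases key v hv0 with h | h
  · linarith [norm_add_le e v]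
  · linarith [norm_sub_le e v]

lemma exists_plane (hdim : 2 ≤ Module.rank ℝ X) :
    ∃ V : Submodule ℝ X, FiniteDimensional ℝ V ∧ Module.finrank ℝ V = 2 := by
  obtain ⟨s, hs, hli⟩ := le_rank_iff_exists_linearIndependent_finset.1
    (show ((2 : ℕ) : Cardinal) ≤ Module.rank ℝ X by exact_mod_cast hdim)
  refine ⟨Submodule.span ℝ (s : Set X), FiniteDimensional.span_finset ℝ s, ?_⟩
  rw [finrank_span_finset_eq_card hli, hs]

lemma exists_pair_A (hdim : 2 ≤ Module.rank ℝ X) :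
    ∃ x y : X, ‖x‖ = 1 ∧ ‖y‖ = 1 ∧ Quasiorth x y ∧
      ∀ s : ℝ, 0 < s → 1 < ‖x + s • y‖ ∨ 1 < ‖x - s • y‖ := by
  obtain ⟨V, hV, hr⟩ := exists_plane hdim
  have : Nontrivial V := Module.nontrivial_of_finrank_pos (R := ℝ) (by omega)
  obtain ⟨e, he, hext⟩ := exists_ext_pt V
  obtain ⟨p, hp, hpe⟩ := exists_dual_vector ℝ (e : X)
    (by rw [Submodule.norm_coe, he]; exact one_ne_zero)
  have hker := LinearMap.ker_ne_bot_of_finrank_lt (f := (p.toLinearMap.comp V.subtype))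
    (by simp [hr])
  obtain ⟨z, hz, hz0⟩ := Submodule.exists_mem_ne_zero_of_ne_bot hker
  have hz1 : p (z : X) = 0 := by simpa using hz
  have hzn : ‖z‖ ≠ 0 := norm_ne_zero_iff.2 hz0
  refine ⟨e, ((‖z‖⁻¹ • z : V) : X), by simpa using he, ?_, ⟨p, hp, by simpa using hpe, ?_⟩, ?_⟩
  · change ‖(‖z‖⁻¹ • z : V)‖ = 1
    rw [norm_smul, norm_inv, norm_norm, inv_mul_cancel₀ hzn]
  · simp [hz1]
  · intro s hs
    exact hext (s • (‖z‖⁻¹ • z)) (by simp [hs.ne', hz0])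

lemma exists_pair_B (hdim : 2 ≤ Module.rank ℝ X) :
    ∃ x y : X, ‖x‖ = 1 ∧ ‖y‖ = 1 ∧ Quasiorth x y ∧
      ∀ s : ℝ, 0 < s → 1 < ‖y + s • x‖ ∨ 1 < ‖y - s • x‖ := by
  obtain ⟨V, hV, hr⟩ := exists_plane hdim
  have : Nontrivial V := Module.nontrivial_of_finrank_pos (R := ℝ) (by omega)
  have : ProperSpace V := FiniteDimensional.proper ℝ V
  obtain ⟨e, he, hext⟩ := exists_ext_pt V
  have hlt : Submodule.span ℝ {e} < ⊤ := by
    rw [lt_top_iff_ne_top]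
    intro h
    have h1 := finrank_span_singleton (K := ℝ) (v := e) (by rintro rfl; simp at he)
    rw [h, finrank_top] at h1
    omega
  obtain ⟨f, hf0, hf⟩ := Submodule.exists_dual_map_eq_bot_of_lt_top hlt inferInstance
  have hfe : f e = 0 := by
    have : f e ∈ Submodule.map f (Submodule.span ℝ {e}) :=
      Submodule.mem_map_of_mem (Submodule.mem_span_singleton_self e)
    rw [hf] at this
    simpa using this
  let q : V →L[ℝ] ℝ := LinearMap.toContinuousLinearMap f
  have hqf : ∀ v, q v = f v := fun v => rfl
  obtain ⟨x, hx, hmax⟩ := (isCompact_closedBall (0 : V) 1).exists_isMaxOn ⟨0, by simp⟩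
    q.continuous.continuousOn
  have hx1 : ‖x‖ ≤ 1 := by simpa using hx
  have hbd : ∀ v : V, ‖v‖ ≤ 1 → q v ≤ q x := fun v hv => hmax (by simpa using hv)
  have hM0 : 0 ≤ q x := by simpa using hbd 0 (by simp)
  have hle : ‖q‖ ≤ q x := by
    refine q.opNorm_le_of_unit_norm hM0 ?_
    intro v hv
    rw [Real.norm_eq_abs, abs_le]
    have h1 := hbd v hv.le
    have h2 := hbd (-v) (by simp [hv])
    rw [map_neg] at h2
    constructor <;> linarith
  have hqpos : 0 < ‖q‖ := by
    by_contra! hn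
    apply hf0
    ext v
    have h1 := q.le_opNorm v
    have h2 : ‖q v‖ ≤ 0 := h1.trans (mul_nonpos_of_nonpos_of_nonneg hn (norm_nonneg v))
    rw [← hqf]
    exact norm_le_zero_iff.1 h2
  have hle2 : q x ≤ ‖q‖ * ‖x‖ := (le_abs_self _).trans (q.le_opNorm x)
  have hxn : ‖x‖ = 1 := by
    refine le_antisymm hx1 ?_
    by_contra! hlt
    nlinarith
  have hqx : q x = ‖q‖ := by
    rw [hxn, mul_one] at hle2
    exact le_antisymm hle2 hle
  obtain ⟨g, hg, hgn⟩ := exists_extension_norm_eq V q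
  refine ⟨x, e, by simpa using hxn, by simpa using he, ⟨‖q‖⁻¹ • g, ?_, ?_, ?_⟩, ?_⟩
  · rw [norm_smul, hgn]
    rw [norm_inv, Real.norm_eq_abs, abs_of_pos hqpos, inv_mul_cancel₀ hqpos.ne']
  · have : ‖(x : X)‖ = 1 := by simpa using hxn
    rw [this, smul_apply, hg, hqx, smul_eq_mul, inv_mul_cancel₀ hqpos.ne']
  · rw [smul_apply, hg, hqf, hfe, smul_zero]
  · intro s hs
    have hx0 : x ≠ 0 := by rintro rfl; simp at hxn
    exact hext (s • x) (by simp [hs.ne', hx0])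

lemma suppLam_gt {x y : X} (h : Quasiorth x y) (hx : ‖x‖ = 1) (hy : ‖y‖ = 1) {ε : ℝ}
    (hε : 0 < ε) (hgt : 1 < ‖y + ε • x‖) : 1 - ε < suppLam x y 1 := by
  by_contra! hle
  have h1 := suppLam_mem h hx hy zero_le_one le_rfl
  set L := suppLam x y 1
  have hL : 0 < 1 - L := by linarith
  set c := ε / (1 - L) with hc
  have hc0 : 0 ≤ c := by positivity
  have hc1 : c ≤ 1 := (div_le_one hL).2 (by linarith)
  have he : ε = c * (1 - L) := by rw [hc]; field_simp
  have : y + ε • x = (1 - c) • y + c • (x + (1 : ℝ) • y - L • x) := by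
    rw [he]; module
  rw [this] at hgt
  have h2 := norm_add_le ((1 - c) • y) (c • (x + (1 : ℝ) • y - L • x))
  rw [norm_smul, norm_smul, h1, hy, Real.norm_of_nonneg hc0,
    Real.norm_of_nonneg (by linarith)] at h2
  linarith

lemma suppLam_pos {x y : X} (h : Quasiorth x y) (hx : ‖x‖ = 1) (hy : ‖y‖ = 1) {t : ℝ}
    (ht : 0 ≤ t) (ht1 : t ≤ 1) (hgt : 1 < ‖x + t • y‖) : 0 < suppLam x y t := by
  refine lt_of_le_of_ne (suppLam_nonneg h hx hy ht ht1) ?_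
  intro h0
  have h1 := suppLam_mem h hx hy ht ht1
  rw [← h0, zero_smul, sub_zero] at h1
  linarith

lemma le_suppSmoothness {x y : X} (h : Quasiorth x y) (hx : ‖x‖ = 1) (hy : ‖y‖ = 1) {t r : ℝ}
    (ht : 0 ≤ t) (htr : t ≤ r) (hr : r ≤ 1) :
    max (suppLam x y t) (suppLam x (-y) t) ≤ suppSmoothness X r := by
  refine le_csSup ⟨1, ?_⟩ ⟨x, y, t, hx, hy, h, ht, htr, rfl⟩
  rintro v ⟨x, y, t, hx, hy, h, ht, htr, rfl⟩
  exact max_le (suppLam_le_one h hx hy ht (htr.trans hr))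
    (suppLam_le_one h.neg' hx (by simpa using hy) ht (htr.trans hr))

end Helpers

theorem suppSmoothness_pos_strictMono {X : Type*} [NormedAddCommGroup X] [NormedSpace ℝ X]
    [CompleteSpace X] (hdim : 2 ≤ Module.rank ℝ X) :
    (∀ r : ℝ, 0 < r → r ≤ 1 → 0 < suppSmoothness X r) ∧
    StrictMonoOn (suppSmoothness X) (Set.Icc (0 : ℝ) 1) ∧
    suppSmoothness X 1 = 1 := by
  have hpos : ∀ r : ℝ, 0 < r → r ≤ 1 → 0 < suppSmoothness X r := by
    intro r hr hr1
    obtain ⟨x, y, hx, hy, h, hs⟩ := exists_pair_A hdim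
    refine lt_of_lt_of_le ?_ (le_suppSmoothness h hx hy hr.le le_rfl hr1)
    rcases hs r hr with h1 | h1
    · exact lt_max_of_lt_left (suppLam_pos h hx hy hr.le hr1 h1)
    · refine lt_max_of_lt_right (suppLam_pos h.neg' hx (by simpa using hy) hr.le hr1 ?_)
      rwa [smul_neg, ← sub_eq_add_neg]
  obtain ⟨x₀, y₀, hx₀, hy₀, h₀, hs₀⟩ := exists_pair_B hdim
  refine ⟨hpos, ?_, ?_⟩
  · intro a ha b hb hab
    have hb0 : 0 < b := ha.1.trans_lt hab
    have hp := hpos b hb0 hb.2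
    refine lt_of_le_of_lt (b := a / b * suppSmoothness X b) ?_ ?_
    · refine csSup_le ⟨_, x₀, y₀, 0, hx₀, hy₀, h₀, le_rfl, ha.1, rfl⟩ ?_
      rintro v ⟨x, y, t, hx, hy, h, ht, hta, rfl⟩
      have hy' : ‖-y‖ = 1 := by simpa using hy
      have hm := le_suppSmoothness h hx hy hb0.le le_rfl hb.2
      have htb : t / b ≤ a / b := by gcongr
      have hab0 : 0 ≤ a / b := div_nonneg ha.1 hb0.le
      refine max_le ?_ ?_
      · refine (suppLam_scale h hx hy ht (hta.trans hab.le) hb0 hb.2).trans ?_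
        exact mul_le_mul htb ((le_max_left _ _).trans hm)
          (suppLam_nonneg h hx hy hb0.le hb.2) hab0
      · refine (suppLam_scale h.neg' hx hy' ht (hta.trans hab.le) hb0 hb.2).trans ?_
        exact mul_le_mul htb ((le_max_right _ _).trans hm)
          (suppLam_nonneg h.neg' hx hy' hb0.le hb.2) hab0
    · have : a / b < 1 := (div_lt_one hb0).2 hab
      nlinarith
  · refine le_antisymm ?_ ?_
    · refine csSup_le ⟨_, x₀, y₀, 0, hx₀, hy₀, h₀, le_rfl, zero_le_one, rfl⟩ ?_
      rintro v ⟨x, y, t, hx, hy, h, ht, hta, rfl⟩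
      exact max_le (suppLam_le_one h hx hy ht hta)
        (suppLam_le_one h.neg' hx (by simpa using hy) ht hta)
    · refine le_of_forall_pos_le_add fun ε hε => ?_
      have hm := le_suppSmoothness h₀ hx₀ hy₀ zero_le_one le_rfl le_rfl
      rcases hs₀ ε hε with h1 | h1
      · have := suppLam_gt h₀ hx₀ hy₀ hε h1
        linarith [(le_max_left _ _).trans hm]
      · have := suppLam_gt h₀.neg' hx₀ (by simpa using hy₀) hε
          (by rwa [neg_add_eq_sub, norm_sub_rev])
        linarith [(le_max_right _ _).trans hm]
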